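/- Let P be an optimistic DAG MPCS protocol over a set S of signers with k = |S|, and let v ∈ Sig(P). If for every signer a ∈ S ∖ {r(v)} there is a vertex w ≺ v with r(w) = a such that every permutation of S ∖ {a} occurs as a (not necessarily consecutive) subsequence of some sequence in seq(I, w), then every permutation of S ∖ {r(v)} occurs as a subsequence of some sequence in seq(I, v). -/

import Mathlib

attribute [local instance] Classical.propDecidable

/-- Causal precedence: a nonempty directed path. -/
def cprec {V : Type} (E : V → V → Prop) : V → V → Prop := Relation.TransGen E

/-- Reflexive causal precedence. -/
def cpreceq {V : Type} (E : V → V → Prop) (v w : V) : Prop := cprec E v w ∨ v = w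

/-- A DAG MPCS protocol over vertex type `V` and signer type `S`. -/
structure MPCS (V S : Type) where
  E : V → V → Prop
  vT : V
  role : V → Option S
  Sigma0 : Set V
  vfin : Finite V
  sfin : Finite S
  two_le_card : 2 ≤ Nat.card S
  acyclic : ∀ v, ¬ cprec E v v
  vT_role : role vT = none
  role_eq_none : ∀ v, role v = none → v = vT
  exit_edges : ∀ v, v ≠ vT → E v vT
  msg_structure : ∀ v w, cprec E v w →
    E v w ∨ ∃ u, cprec E v u ∧ cprec E u w ∧ (role u = role v ∨ role u = role w)

namespace MPCS

variable {V S : Type} (P : MPCS V S)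

def epsEdge (e : V × V) : Prop := P.E e.1 e.2 ∧ P.role e.1 = P.role e.2

def exitEdge (e : V × V) : Prop := P.E e.1 e.2 ∧ e.2 = P.vT

def msgEdge (e : V × V) : Prop := P.E e.1 e.2 ∧ P.role e.1 ≠ P.role e.2 ∧ e.2 ≠ P.vT

/-- The knowledge of a vertex. -/
def K (v : V) : Set (V × V) :=
  {e | P.msgEdge e ∧ cpreceq P.E e.2 v ∧ P.role e.2 = P.role v}

/-- The pre-knowledge of a vertex. -/
def Kpre (v : V) : Set (V × V) :=
  {e | P.msgEdge e ∧ cprec P.E e.2 v ∧ P.role e.2 = P.role v}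

def KpreSet (U : Set V) : Set (V × V) := ⋃ v ∈ U, P.Kpre v

/-- The signing set Sig(P). -/
def Sig : Set V := {v ∈ P.Sigma0 | ∃ w, P.msgEdge (v, w)}

/-- The initial set Init(P). -/
def InitSet : Set V :=
  {v | {a : S | (∃ e ∈ P.Kpre v, P.role e.1 = some a) ∨ P.role v = some a} ≠ Set.univ}

/-- The end set End(P). -/
def EndSet : Set V :=
  {v | {a : S | (∃ e ∈ P.K v, e.1 ∈ P.Sig ∧ P.role e.1 = some a) ∨ P.role v = some a} = Set.univ}

def Optimistic : Prop :=
  ∀ a : S, (∃ v ∈ P.Sig, P.role v = some a) ∧ (∃ v ∈ P.EndSet, P.role v = some a)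

def hon (v : V) (U : Set V) : Prop :=
  ¬ ∃ e ∈ P.KpreSet U, cpreceq P.E v e.1 ∧ P.role e.1 = P.role v

/-- `(v₁, …, v_l | s)` is an abort-chaining sequence. -/
def IsAC (vs : List V) (s : V) : Prop :=
  vs ≠ [] ∧ vs.length ≤ Nat.card S ∧
  (∀ h : vs ≠ [], vs.head h ∈ P.InitSet) ∧
  vs.Pairwise (fun v w => P.role v ≠ P.role w) ∧
  (∀ i (hi : i < vs.length), P.hon (vs.get ⟨i, hi⟩) {w | w ∈ vs.take (i + 1)}) ∧
  (∀ i (hi : i + 1 < vs.length),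
    P.hon (vs.get ⟨i, Nat.lt_of_succ_lt hi⟩) {w | w ∈ vs.take (i + 2)}) ∧
  (∀ h : vs ≠ [],
    (∀ v, cprec P.E v (vs.getLast h) → P.role v = P.role (vs.getLast h) → v ∉ P.EndSet) ∧
    s ∈ P.Sig ∧ s ∉ P.EndSet ∧ P.role s = P.role (vs.getLast h) ∧
    ¬ cpreceq P.E (vs.getLast h) s)

def NoAC : Prop := ¬ ∃ vs s, P.IsAC vs s

/-- The set I of causally last vertices of each signer in the initial set. -/
def Iset : Set V :=
  {v ∈ P.InitSet | ∀ w, cprec P.E v w → P.role v = P.role w → w ∉ P.InitSet}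

def PathFrom (I : Set V) (v : V) (p : List V) : Prop :=
  ∃ h : p ≠ [], p.Chain' P.E ∧ p.head h ∈ I ∧ p.getLast h = v

/-- Every permutation of `S ∖ {r(v)}` appears as a subsequence of a sequence in seq(I, v). -/
def PermCond (v : V) : Prop :=
  ∀ as : List S, as.Nodup → (∀ b : S, b ∈ as ↔ some b ≠ P.role v) →
    ∃ p, P.PathFrom P.Iset v p ∧ (as.map some).Sublist (p.map P.role)

end MPCS

namespace MPCS

variable {V S : Type} {P : MPCS V S}

/-- A path ending in `w` extends to any vertex causally after `w`. -/
theorem PathFrom.exists_prefix_of_cprec {I : Set V} {w v : V} {p : List V}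
    (hp : P.PathFrom I w p) (hwv : cprec P.E w v) :
    ∃ q, P.PathFrom I v q ∧ p <+: q := by
  have snoc : ∀ {x y : V} {q : List V}, P.PathFrom I x q → P.E x y →
      P.PathFrom I y (q ++ [y]) := by
    rintro x y q ⟨hne, hchain, hhead, hlast⟩ hxy
    refine ⟨by simp, ?_, by simpa [List.head_append_of_ne_nil hne] using hhead, by simp⟩
    refine List.isChain_append.2 ⟨hchain, by simp, ?_⟩
    intro a ha b hb
    obtain rfl : y = b := by simpa using hb
    obtain rfl : x = a := by simpa [List.getLast?_eq_some_getLast hne, hlast] using ha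
    exact hxy
  induction hwv with
  | single hxy => exact ⟨_, snoc hp hxy, List.prefix_append _ _⟩
  | tail _ hxy ih =>
    obtain ⟨q, hq, hpq⟩ := ih
    exact ⟨_, snoc hq hxy, hpq.trans (List.prefix_append _ _)⟩

end MPCS

/-- A sublist of `l ++ [a]` avoiding `a` can be completed by the final `a`. -/
theorem List.Sublist.concat_of_notMem {α : Type*} {s l : List α} {a : α}
    (h : s.Sublist (l ++ [a])) (ha : a ∉ s) : (s ++ [a]).Sublist (l ++ [a]) := by
  obtain ⟨s₁, s₂, rfl, h₁, h₂⟩ := List.sublist_append_iff.1 h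
  rcases List.sublist_singleton.1 h₂ with rfl | rfl
  · simpa using h₁
  · simp at ha

/-- **Fact 2.** If `v ∈ Sig(P)` and for every signer `a ≠ r(v)` there is a
vertex `w ≺ v` with role `a` satisfying the permutation condition, then `v` satisfies the
permutation condition. -/
theorem perm_condition_from_predecessors {V S : Type} (P : MPCS V S)
    (hopt : P.Optimistic) (v : V) (hv : v ∈ P.Sig)
    (h : ∀ a : S, some a ≠ P.role v →
      ∃ w, cprec P.E w v ∧ P.role w = some a ∧ P.PermCond w) :
    P.PermCond v := by
  intro as hnd hmem
  rcases List.eq_nil_or_concat' as with rfl | ⟨bs, a, rfl⟩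
  · have := P.sfin
    have : Nontrivial S := Finite.one_lt_card_iff_nontrivial.1 P.two_le_card
    obtain ⟨x, y, hxy⟩ := exists_pair_ne S
    simp only [List.not_mem_nil, false_iff, not_not] at hmem
    exact absurd (Option.some_injective S ((hmem x).trans (hmem y).symm)) hxy
  obtain ⟨w, hwv, hwa, hw⟩ := h a ((hmem a).1 (by simp))
  have hbs : bs.Nodup ∧ a ∉ bs := by
    simpa [List.nodup_append, and_comm, imp_not_comm] using hnd
  obtain ⟨hbsnd, habs⟩ := hbs
  have hva : some a ≠ P.role v := (hmem a).1 (by simp)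
  obtain ⟨p, hp, hsub⟩ := hw ((P.role v).toList ++ bs)
    (by
      refine List.nodup_append.2 ⟨by cases P.role v <;> simp, hbsnd, ?_⟩
      rintro b hb _ hc rfl
      exact (hmem b).1 (by simp [hc]) (Option.mem_toList.1 hb).symm)
    (by
      intro b
      have hb := hmem b
      simp only [List.mem_append, List.mem_singleton] at hb
      rw [List.mem_append, Option.mem_toList, hwa, Ne, Option.some_inj]
      constructor
      · rintro (h' | h') rfl
        · exact hva h'.symm
        · exact habs h'
      · intro hne
        by_cases h' : P.role v = some b
        · exact Or.inl h'
        · exact Or.inr ((hb.2 (Ne.symm h')).resolve_right hne))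
  obtain ⟨q, hq, hpq⟩ := hp.exists_prefix_of_cprec hwv
  refine ⟨q, hq, List.Sublist.trans ?_ (hpq.sublist.map P.role)⟩
  obtain ⟨hne, -, -, hlast⟩ := hp
  have hmap : p.map P.role = p.dropLast.map P.role ++ [some a] := by
    conv_lhs => rw [← List.dropLast_append_getLast hne, hlast]
    simp [hwa]
  rw [List.map_append] at hsub
  rw [hmap] at hsub ⊢
  simpa using ((List.sublist_append_right _ _).trans hsub).concat_of_notMem (by simpa using habs)
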